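/- arXiv:2206.13372 — 7 statements merged into one kernel-verified Lean document; each statement's English description precedes it below -/
import Mathlib

section
/- Let G and H be finite connected simple graphs, each of minimum degree at least 3. Then G and H are isomorphic if and only if the graphs G' and H' (obtained from G and H respectively by the double-subdivision-plus-join-plus-complement construction) are isomorphic. -/
open SimpleGraph
open scoped Classical

/-- The incidences of a graph `G`: pairs `(v, e)` where `e ∈ E(G)` and `v` is an
endpoint of `e`. This is the set `V2` of the construction. -/
abbrev SimpleGraph.Incidences {V : Type*} (G : SimpleGraph V) : Type _ :=
  {p : V × G.edgeSet // p.1 ∈ (p.2 : Sym2 V)}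

/-- `G2`: the graph obtained from `G` by subdividing every edge twice.  Its vertex set is
`V ⊕ V1 ⊕ V2` (with `V1 = E(G)` and `V2` the incidences of `G`), and its edges are exactly
`{v, (v,e)}` and `{e, (v,e)}` for every incidence `(v,e)`. -/
def SimpleGraph.subdivTwice {V : Type*} (G : SimpleGraph V) :
    SimpleGraph (V ⊕ (G.edgeSet ⊕ G.Incidences)) :=
  SimpleGraph.fromRel fun x y =>
    match x, y with
    | Sum.inl v, Sum.inr (Sum.inr i) => i.val.1 = v
    | Sum.inr (Sum.inl e), Sum.inr (Sum.inr i) => i.val.2 = e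
    | _, _ => False

/-- `G3`: the graph obtained from `G2` by adding all edges `{v, e}` with `v ∈ V`
and `e ∈ V1 = E(G)`. -/
def SimpleGraph.gThree {V : Type*} (G : SimpleGraph V) :
    SimpleGraph (V ⊕ (G.edgeSet ⊕ G.Incidences)) :=
  G.subdivTwice ⊔ (SimpleGraph.fromRel fun x y =>
    match x, y with
    | Sum.inl _, Sum.inr (Sum.inl _) => True
    | _, _ => False)

/-- `G'`: the complement of `G3`. -/
def SimpleGraph.gPrime {V : Type*} (G : SimpleGraph V) :
    SimpleGraph (V ⊕ (G.edgeSet ⊕ G.Incidences)) :=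
  (G.gThree)ᶜ

/-- A circular arc in `ZMod n`: a set of the form `{a, a+1, …, a+k}`. -/
def IsCircularArc {n : ℕ} (A : Set (ZMod n)) : Prop :=
  ∃ (a : ZMod n) (k : ℕ), A = {x | ∃ j : ℕ, j ≤ k ∧ x = a + (j : ZMod n)}

/-- A proper circular-arc representation of `G` on `ZMod n`: every vertex gets a circular
arc, distinct vertices are adjacent iff their arcs intersect, and no arc of a vertex is a
strict subset of the arc of another vertex. -/
def IsProperCircularArcRep {W : Type*} (G : SimpleGraph W) {n : ℕ}
    (f : W → Set (ZMod n)) : Prop :=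
  (∀ v, IsCircularArc (f v)) ∧
  (∀ u w, u ≠ w → (G.Adj u w ↔ (f u ∩ f w).Nonempty)) ∧
  (∀ u w, u ≠ w → ¬ (f u ⊂ f w))

/-- `G` is a proper circular-arc graph if it admits a proper circular-arc
representation on some `ZMod n` with `n ≥ 1`. -/
def IsProperCircularArcGraph {W : Type*} (G : SimpleGraph W) : Prop :=
  ∃ n : ℕ, 1 ≤ n ∧ ∃ f : W → Set (ZMod n), IsProperCircularArcRep G f

/-- `G` is a disjoint union of stars: every vertex has degree at least `1` and every edge
has an endpoint of degree `1`. -/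
def IsDisjointUnionOfStars {W : Type*} [Fintype W] (G : SimpleGraph W) : Prop :=
  (∀ v, 1 ≤ G.degree v) ∧ (∀ u w, G.Adj u w → G.degree u = 1 ∨ G.degree w = 1)

/-- `B(n,m)`: the graph on `{c} ⊕ Fin n ⊕ Fin m` where `c, x_0, …, x_{n-1}` form a cycle of
length `n+1` and `c, y_0, …, y_{m-1}` form a cycle of length `m+1`; for `n, m ≥ 2` these are
exactly the subdivisions of the graph `B` of two triangles sharing a vertex. -/
def BGraph (n m : ℕ) : SimpleGraph (Unit ⊕ (Fin n ⊕ Fin m)) :=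
  SimpleGraph.fromRel fun a b =>
    match a, b with
    | Sum.inl _, Sum.inr (Sum.inl x) => x.val = 0 ∨ x.val = n - 1
    | Sum.inl _, Sum.inr (Sum.inr y) => y.val = 0 ∨ y.val = m - 1
    | Sum.inr (Sum.inl x), Sum.inr (Sum.inl x') => x'.val = x.val + 1
    | Sum.inr (Sum.inr y), Sum.inr (Sum.inr y') => y'.val = y.val + 1
    | _, _ => False

/-- `H` is a proper `B`-graph: there is a subdivision `B(n,m)` of `B` and an assignment of
nonempty connected subsets of `B(n,m)` to the vertices of `H` such that distinct vertices are
adjacent iff their subsets intersect, and no subset is a strict subset of another. -/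
def IsProperBGraph {W : Type*} (H : SimpleGraph W) : Prop :=
  ∃ n m : ℕ, 2 ≤ n ∧ 2 ≤ m ∧
    ∃ f : W → Set (Unit ⊕ (Fin n ⊕ Fin m)),
      (∀ v, (f v).Nonempty) ∧
      (∀ v, ((BGraph n m).induce (f v)).Connected) ∧
      (∀ u w, u ≠ w → (H.Adj u w ↔ (f u ∩ f w).Nonempty)) ∧
      (∀ u w, u ≠ w → ¬ (f u ⊂ f w))

namespace SimpleGraph

section Recover

variable {X Y : Type*}

/-- Every neighbour of `x` in `K` is one of two fixed vertices. -/
def HasAtMostTwoNeighbors (K : SimpleGraph X) (x : X) : Prop :=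
  ∃ a b, ∀ y, K.Adj x y → y = a ∨ y = b

/-- The vertices of a graph that play the role of edges in `gThree`: they have more than two
neighbours, but at most two neighbours that themselves have at most two neighbours. -/
def IsEdgeLike (K : SimpleGraph X) (x : X) : Prop :=
  ¬ K.HasAtMostTwoNeighbors x ∧
    ∃ a b, ∀ y, K.Adj x y → K.HasAtMostTwoNeighbors y → y = a ∨ y = b

/-- The vertices of a graph that play the role of original vertices in `gThree`. -/
def IsVertexLike (K : SimpleGraph X) (x : X) : Prop :=
  ¬ K.HasAtMostTwoNeighbors x ∧ ¬ K.IsEdgeLike x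

/-- The graph on the vertex-like vertices of `K`, where two of them are adjacent when they are
joined to a common edge-like vertex by paths through vertices with at most two neighbours. -/
def recover (K : SimpleGraph X) : SimpleGraph {x // K.IsVertexLike x} where
  Adj x y := x ≠ y ∧ ∃ e i j, K.IsEdgeLike e ∧ K.HasAtMostTwoNeighbors i ∧
    K.HasAtMostTwoNeighbors j ∧ K.Adj e i ∧ K.Adj e j ∧ K.Adj x i ∧ K.Adj y j
  symm := ⟨fun _ _ ⟨h, e, i, j, he, hi, hj, h₁, h₂, h₃, h₄⟩ =>
    ⟨h.symm, e, j, i, he, hj, hi, h₂, h₁, h₄, h₃⟩⟩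
  loopless := ⟨fun _ h => h.1 rfl⟩

variable {K : SimpleGraph X} {L : SimpleGraph Y}

/-- An isomorphism of graphs is an isomorphism of their complements. -/
def Iso.complement (f : K ≃g L) : Kᶜ ≃g Lᶜ where
  toEquiv := f.toEquiv
  map_rel_iff' := by simp [compl_adj, f.map_adj_iff]

theorem Iso.hasAtMostTwoNeighbors_iff (f : K ≃g L) (x : X) :
    L.HasAtMostTwoNeighbors (f x) ↔ K.HasAtMostTwoNeighbors x := by
  simp only [HasAtMostTwoNeighbors,
    f.surjective.exists, f.surjective.forall, f.map_adj_iff, f.injective.eq_iff]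

theorem Iso.isEdgeLike_iff (f : K ≃g L) (x : X) : L.IsEdgeLike (f x) ↔ K.IsEdgeLike x := by
  simp only [IsEdgeLike, f.surjective.exists, f.surjective.forall, f.map_adj_iff,
    f.injective.eq_iff, f.hasAtMostTwoNeighbors_iff]

theorem Iso.isVertexLike_iff (f : K ≃g L) (x : X) :
    L.IsVertexLike (f x) ↔ K.IsVertexLike x := by
  simp only [IsVertexLike, f.hasAtMostTwoNeighbors_iff, f.isEdgeLike_iff]

/-- Isomorphic graphs have isomorphic recovered graphs. -/
def Iso.recover (f : K ≃g L) : K.recover ≃g L.recover where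
  toEquiv := f.toEquiv.subtypeEquiv fun x => (f.isVertexLike_iff x).symm
  map_rel_iff' := by
    rintro ⟨x, hx⟩ ⟨y, hy⟩
    simp [SimpleGraph.recover, f.surjective.exists, f.map_adj_iff,
      f.hasAtMostTwoNeighbors_iff, f.isEdgeLike_iff]

end Recover

section GThree

variable {V W : Type*} (G : SimpleGraph V) {H : SimpleGraph W}

@[simp] theorem gThree_adj_inl_inl (u v : V) :
    ¬ G.gThree.Adj (.inl u) (.inl v) := by
  simp [gThree, subdivTwice]

@[simp] theorem gThree_adj_inl_edge (v : V) (e : G.edgeSet) :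
    G.gThree.Adj (.inl v) (.inr (.inl e)) := by
  simp [gThree, subdivTwice]

@[simp] theorem gThree_adj_edge_inl (v : V) (e : G.edgeSet) :
    G.gThree.Adj (.inr (.inl e)) (.inl v) := by
  simp [gThree, subdivTwice]

@[simp] theorem gThree_adj_inl_incidence (v : V) (i : G.Incidences) :
    G.gThree.Adj (.inl v) (.inr (.inr i)) ↔ i.val.1 = v := by
  simp [gThree, subdivTwice]

@[simp] theorem gThree_adj_incidence_inl (v : V) (i : G.Incidences) :
    G.gThree.Adj (.inr (.inr i)) (.inl v) ↔ i.val.1 = v := by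
  simp [gThree, subdivTwice]

@[simp] theorem gThree_adj_edge_edge (e e' : G.edgeSet) :
    ¬ G.gThree.Adj (.inr (.inl e)) (.inr (.inl e')) := by
  simp [gThree, subdivTwice]

@[simp] theorem gThree_adj_edge_incidence (e : G.edgeSet) (i : G.Incidences) :
    G.gThree.Adj (.inr (.inl e)) (.inr (.inr i)) ↔ i.val.2 = e := by
  simp [gThree, subdivTwice]

@[simp] theorem gThree_adj_incidence_edge (e : G.edgeSet) (i : G.Incidences) :
    G.gThree.Adj (.inr (.inr i)) (.inr (.inl e)) ↔ i.val.2 = e := by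
  simp [gThree, subdivTwice]

@[simp] theorem gThree_adj_incidence_incidence (i j : G.Incidences) :
    ¬ G.gThree.Adj (.inr (.inr i)) (.inr (.inr j)) := by
  simp [gThree, subdivTwice]

variable {G}

/-- An isomorphism of graphs induces an isomorphism of their `gThree` graphs. -/
def Iso.gThree (f : G ≃g H) : G.gThree ≃g H.gThree where
  toEquiv := f.toEquiv.sumCongr (f.mapEdgeSet.sumCongr
    ((f.toEquiv.prodCongr f.mapEdgeSet).subtypeEquiv fun p => by
      obtain ⟨v, e, he⟩ := p
      simp [Iso.mapEdgeSet, Hom.mapEdgeSet]))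
  map_rel_iff' := by
    rintro (u | e | i) (v | e' | j) <;>
      simp [-Iso.mapEdgeSet_apply, f.mapEdgeSet.injective.eq_iff]

theorem gThree_hasAtMostTwoNeighbors_incidence (i : G.Incidences) :
    G.gThree.HasAtMostTwoNeighbors (.inr (.inr i)) := by
  refine ⟨.inl i.val.1, .inr (.inl i.val.2), ?_⟩
  rintro (v | e | j) h <;> simp_all

variable [Fintype V]

theorem exists_neighbor_ne_ne {X : Type*} {v : V} (hv : 3 ≤ G.degree v)
    {f : G.neighborSet v → X} (hf : f.Injective) (a b : X) : ∃ w, f w ≠ a ∧ f w ≠ b := by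
  rw [← card_neighborSet_eq_degree] at hv
  obtain ⟨x, y, z, hxy, hxz, hyz⟩ := Fintype.two_lt_card_iff.1 hv
  have := hf.ne hxy
  have := hf.ne hxz
  have := hf.ne hyz
  by_contra! h
  have := or_iff_not_imp_left.2 (h x)
  have := or_iff_not_imp_left.2 (h y)
  have := or_iff_not_imp_left.2 (h z)
  grind

theorem exists_gThree_incidence_adj_inl (hG : ∀ v, 3 ≤ G.degree v) (v : V)
    (a b : V ⊕ (G.edgeSet ⊕ G.Incidences)) :
    ∃ i : G.Incidences, G.gThree.Adj (.inl v) (.inr (.inr i)) ∧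
      .inr (.inr i) ≠ a ∧ .inr (.inr i) ≠ b := by
  let i (w : G.neighborSet v) : G.Incidences :=
    ⟨(v, ⟨s(v, w), w.2⟩), Sym2.mem_mk_left v w⟩
  have hi : i.Injective := fun w w' h =>
    Subtype.ext (Sym2.congr_right.1 (congrArg (fun i : G.Incidences => i.val.2.val) h))
  obtain ⟨w, ha, hb⟩ :=
    exists_neighbor_ne_ne (hG v) (Sum.inr_injective.comp (Sum.inr_injective.comp hi)) a b
  exact ⟨i w, by simp [i], ha, hb⟩

theorem gThree_not_hasAtMostTwoNeighbors_inl (hG : ∀ v, 3 ≤ G.degree v) (v : V) :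
    ¬ G.gThree.HasAtMostTwoNeighbors (.inl v) := by
  rintro ⟨a, b, h⟩
  obtain ⟨i, hi, ha, hb⟩ := exists_gThree_incidence_adj_inl hG v a b
  exact (h _ hi).elim ha hb

theorem gThree_not_isEdgeLike_inl (hG : ∀ v, 3 ≤ G.degree v) (v : V) :
    ¬ G.gThree.IsEdgeLike (.inl v) := by
  rintro ⟨-, a, b, h⟩
  obtain ⟨i, hi, ha, hb⟩ := exists_gThree_incidence_adj_inl hG v a b
  exact (h _ hi (gThree_hasAtMostTwoNeighbors_incidence i)).elim ha hb

theorem gThree_not_hasAtMostTwoNeighbors_edge (hG : ∀ v, 3 ≤ G.degree v) (e : G.edgeSet) :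
    ¬ G.gThree.HasAtMostTwoNeighbors (.inr (.inl e)) := by
  rintro ⟨a, b, h⟩
  obtain ⟨⟨v, w⟩, he⟩ := e
  obtain ⟨u, ha, hb⟩ :=
    exists_neighbor_ne_ne (hG v) (Sum.inl_injective.comp Subtype.val_injective) a b
  exact (h (.inl u) (by simp)).elim ha hb

theorem gThree_isEdgeLike_edge (hG : ∀ v, 3 ≤ G.degree v) (e : G.edgeSet) :
    G.gThree.IsEdgeLike (.inr (.inl e)) := by
  refine ⟨gThree_not_hasAtMostTwoNeighbors_edge hG e, ?_⟩
  obtain ⟨⟨v, w⟩, he⟩ := e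
  refine ⟨.inr (.inr ⟨(v, ⟨s(v, w), he⟩), Sym2.mem_mk_left v w⟩),
    .inr (.inr ⟨(w, ⟨s(v, w), he⟩), Sym2.mem_mk_right v w⟩), ?_⟩
  rintro (u | e' | ⟨⟨u, e'⟩, hu⟩) h h2
  · exact absurd h2 (gThree_not_hasAtMostTwoNeighbors_inl hG u)
  · simp at h
  · obtain rfl : e' = _ := (gThree_adj_edge_incidence ..).1 h
    obtain rfl | rfl : u = v ∨ u = w := Sym2.mem_iff.1 hu
    · exact .inl rfl
    · exact .inr rfl

theorem gThree_hasAtMostTwoNeighbors_iff (hG : ∀ v, 3 ≤ G.degree v)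
    (x : V ⊕ (G.edgeSet ⊕ G.Incidences)) :
    G.gThree.HasAtMostTwoNeighbors x ↔ ∃ i, x = .inr (.inr i) := by
  obtain v | e | i := x
  · simp [gThree_not_hasAtMostTwoNeighbors_inl hG]
  · simp [gThree_not_hasAtMostTwoNeighbors_edge hG]
  · simp [gThree_hasAtMostTwoNeighbors_incidence]

theorem gThree_isEdgeLike_iff (hG : ∀ v, 3 ≤ G.degree v)
    (x : V ⊕ (G.edgeSet ⊕ G.Incidences)) :
    G.gThree.IsEdgeLike x ↔ ∃ e, x = .inr (.inl e) := by
  obtain v | e | i := x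
  · simp [gThree_not_isEdgeLike_inl hG]
  · simp [gThree_isEdgeLike_edge hG]
  · simp [IsEdgeLike, gThree_hasAtMostTwoNeighbors_incidence]

theorem gThree_isVertexLike_iff (hG : ∀ v, 3 ≤ G.degree v)
    (x : V ⊕ (G.edgeSet ⊕ G.Incidences)) :
    G.gThree.IsVertexLike x ↔ ∃ v, .inl v = x := by
  rw [IsVertexLike, gThree_hasAtMostTwoNeighbors_iff hG, gThree_isEdgeLike_iff hG]
  obtain v | e | i := x <;> simp

theorem recover_gThree_adj_iff (hG : ∀ v, 3 ≤ G.degree v) {u v : V}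
    (hu : G.gThree.IsVertexLike (.inl u)) (hv : G.gThree.IsVertexLike (.inl v)) :
    G.gThree.recover.Adj ⟨.inl u, hu⟩ ⟨.inl v, hv⟩ ↔ G.Adj u v := by
  simp only [recover, gThree_isEdgeLike_iff hG, gThree_hasAtMostTwoNeighbors_iff hG,
    ne_eq, Subtype.mk.injEq, Sum.inl.injEq]
  constructor
  · rintro ⟨hne, _, _, _, ⟨e, rfl⟩, ⟨⟨⟨a, e₁⟩, ha⟩, rfl⟩, ⟨⟨⟨b, e₂⟩, hb⟩, rfl⟩, h₁, h₂, h₃, h₄⟩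
    simp only [gThree_adj_edge_incidence, gThree_adj_inl_incidence] at h₁ h₂ h₃ h₄ ha hb
    subst h₁ h₂ h₃ h₄
    rw [← mem_edgeSet, ← (Sym2.mem_and_mem_iff hne).1 ⟨ha, hb⟩]
    exact e₂.2
  · intro h
    exact ⟨h.ne, _, _, _, ⟨⟨s(u, v), h⟩, rfl⟩,
      ⟨⟨(u, ⟨s(u, v), h⟩), Sym2.mem_mk_left u v⟩, rfl⟩,
      ⟨⟨(v, ⟨s(u, v), h⟩), Sym2.mem_mk_right u v⟩, rfl⟩, by simp⟩

/-- A graph of minimum degree at least `3` is recovered from its `gThree` graph. -/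
noncomputable def recoverGThreeIso (hG : ∀ v, 3 ≤ G.degree v) : G ≃g G.gThree.recover where
  toEquiv := Equiv.ofBijective
    (fun v => ⟨.inl v, (gThree_isVertexLike_iff hG _).2 ⟨v, rfl⟩⟩) <| by
      refine ⟨fun u v h => by simpa using h, fun ⟨x, hx⟩ => ?_⟩
      obtain ⟨v, rfl⟩ := (gThree_isVertexLike_iff hG x).1 hx
      exact ⟨v, rfl⟩
  map_rel_iff' := recover_gThree_adj_iff hG _ _

end GThree

end SimpleGraph

/-- For finite connected graphs `G`, `H` of minimum degree at least `3`,
`G ≅ H` iff `G' ≅ H'`. -/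
theorem stmt0 {V W : Type*} [Fintype V] [Fintype W]
    (G : SimpleGraph V) (H : SimpleGraph W)
    (hGc : G.Connected) (hHc : H.Connected)
    (hGd : ∀ v, 3 ≤ G.degree v) (hHd : ∀ w, 3 ≤ H.degree w) :
    Nonempty (G ≃g H) ↔ Nonempty (G.gPrime ≃g H.gPrime) := by
  constructor
  · rintro ⟨f⟩
    exact ⟨f.gThree.complement⟩
  · rintro ⟨f⟩
    have g : G.gThree ≃g H.gThree := by
      simpa only [gPrime, compl_compl] using f.complement
    exact ⟨((recoverGThreeIso hGd).trans g.recover).trans (recoverGThreeIso hHd).symm⟩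
end

section
/- Let G and H be finite connected simple graphs, each of minimum degree at least 3. Then G2 and H2 are isomorphic if and only if G3 and H3 are isomorphic. -/
open SimpleGraph
open scoped Classical

/-- `x` has three distinct neighbours satisfying `P`. -/
def SimpleGraph.HasThreeNeighbors {V : Type*} (G : SimpleGraph V) (P : V → Prop) (x : V) : Prop :=
  ∃ a b c, a ≠ b ∧ a ≠ c ∧ b ≠ c ∧ (G.Adj x a ∧ G.Adj x b ∧ G.Adj x c) ∧ P a ∧ P b ∧ P c

theorem SimpleGraph.HasThreeNeighbors.map {V W : Type*} {G : SimpleGraph V} {H : SimpleGraph W}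
    {P : V → Prop} {Q : W → Prop} (φ : G ≃g H) (h : ∀ x, P x → Q (φ x)) {x : V}
    (hx : G.HasThreeNeighbors P x) : H.HasThreeNeighbors Q (φ x) := by
  obtain ⟨a, b, c, hab, hac, hbc, ⟨ha, hb, hc⟩, pa, pb, pc⟩ := hx
  exact ⟨φ a, φ b, φ c, φ.injective.ne hab, φ.injective.ne hac, φ.injective.ne hbc,
    ⟨φ.map_adj_iff.2 ha, φ.map_adj_iff.2 hb, φ.map_adj_iff.2 hc⟩, h a pa, h b pb, h c pc⟩

theorem SimpleGraph.Iso.hasThreeNeighbors_iff {V W : Type*} {G : SimpleGraph V}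
    {H : SimpleGraph W} {P : V → Prop} {Q : W → Prop} (φ : G ≃g H)
    (h : ∀ x, Q (φ x) ↔ P x) (x : V) :
    H.HasThreeNeighbors Q (φ x) ↔ G.HasThreeNeighbors P x := by
  refine ⟨fun hx => ?_, fun hx => hx.map φ fun x => (h x).2⟩
  have := hx.map (Q := P) φ.symm fun y hy => (h _).1 (by simpa using hy)
  simpa using this

namespace SimpleGraph

variable {V : Type*} {G : SimpleGraph V}

/-- The vertex of the subdivision comes from a vertex of `G`. -/
def IsVertexPoint : V ⊕ (G.edgeSet ⊕ G.Incidences) → Prop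
  | .inl _ => True
  | _ => False

/-- The vertex of the subdivision comes from an edge of `G`. -/
def IsEdgePoint : V ⊕ (G.edgeSet ⊕ G.Incidences) → Prop
  | .inr (.inl _) => True
  | _ => False

/-- The vertex of the subdivision comes from an incidence of `G`. -/
def IsIncidencePoint : V ⊕ (G.edgeSet ⊕ G.Incidences) → Prop
  | .inr (.inr _) => True
  | _ => False

theorem isEdgePoint_iff (x : V ⊕ (G.edgeSet ⊕ G.Incidences)) :
    IsEdgePoint x ↔ ¬ IsVertexPoint x ∧ ¬ IsIncidencePoint x := by
  rcases x with v | e | i <;> simp [IsVertexPoint, IsEdgePoint, IsIncidencePoint]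

theorem gThree_adj_iff (x y : V ⊕ (G.edgeSet ⊕ G.Incidences)) :
    G.gThree.Adj x y ↔ G.subdivTwice.Adj x y ∨
      (IsVertexPoint x ∧ IsEdgePoint y ∨ IsEdgePoint x ∧ IsVertexPoint y) := by
  rcases x with v | e | i <;> rcases y with w | f | j <;>
    simp [gThree, IsVertexPoint, IsEdgePoint]

theorem subdivTwice_adj_iff (x y : V ⊕ (G.edgeSet ⊕ G.Incidences)) :
    G.subdivTwice.Adj x y ↔ G.gThree.Adj x y ∧
      ¬ (IsVertexPoint x ∧ IsEdgePoint y ∨ IsEdgePoint x ∧ IsVertexPoint y) := by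
  rcases x with v | e | i <;> rcases y with w | f | j <;>
    simp [gThree, subdivTwice, IsVertexPoint, IsEdgePoint]

theorem exists_three_incidences_of_vertex [Fintype V] {v : V} (hv : 3 ≤ G.degree v) :
    ∃ a b c : G.Incidences, a ≠ b ∧ a ≠ c ∧ b ≠ c ∧ a.1.1 = v ∧ b.1.1 = v ∧ c.1.1 = v := by
  obtain ⟨a, ha, b, hb, c, hc, hab, hac, hbc⟩ := Finset.two_lt_card.1 hv
  rw [mem_neighborFinset] at ha hb hc
  have key : ∀ {p q : V} (hp : G.Adj v p) (hq : G.Adj v q), p ≠ q →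
      (⟨(v, ⟨s(v, p), hp⟩), by simp⟩ : G.Incidences) ≠ ⟨(v, ⟨s(v, q), hq⟩), by simp⟩ := by
    intro p q hp hq hpq h
    simp [Subtype.ext_iff] at h
    grind
  exact ⟨_, _, _, key ha hb hab, key ha hc hac, key hb hc hbc, rfl, rfl, rfl⟩

theorem exists_two_incidences_of_edge (e : G.edgeSet) :
    ∃ a b : G.Incidences, a ≠ b ∧ a.1.2 = e ∧ b.1.2 = e := by
  obtain ⟨e, he⟩ := e
  induction e with
  | _ p q =>
    refine ⟨⟨(p, ⟨s(p, q), he⟩), by simp⟩, ⟨(q, ⟨s(p, q), he⟩), by simp⟩, ?_, rfl, rfl⟩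
    have : p ≠ q := G.ne_of_adj he
    simpa using this

theorem not_three_incidences_of_edge {e : G.edgeSet} {a b c : G.Incidences}
    (hab : a ≠ b) (hac : a ≠ c) (hbc : b ≠ c) (ha : a.1.2 = e) (hb : b.1.2 = e)
    (hc : c.1.2 = e) : False := by
  obtain ⟨⟨u, _⟩, hu⟩ := a
  obtain ⟨⟨v, _⟩, hv⟩ := b
  obtain ⟨⟨w, _⟩, hw⟩ := c
  dsimp only at ha hb hc
  subst ha hb hc
  rename_i e
  obtain ⟨e, he⟩ := e
  induction e with
  | _ p q =>
    simp at hu hv hw hab hac hbc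
    grind

theorem subdivTwice_adj_edge_iff (e : G.edgeSet) (y : V ⊕ (G.edgeSet ⊕ G.Incidences)) :
    G.subdivTwice.Adj (.inr (.inl e)) y ↔ ∃ i : G.Incidences, y = .inr (.inr i) ∧ i.1.2 = e := by
  rcases y with w | f | j <;> simp [subdivTwice]

theorem subdivTwice_adj_incidence_iff (i : G.Incidences) (y : V ⊕ (G.edgeSet ⊕ G.Incidences)) :
    G.subdivTwice.Adj (.inr (.inr i)) y ↔ y = .inl i.1.1 ∨ y = .inr (.inl i.1.2) := by
  rcases y with w | f | j
  · simp only [subdivTwice, fromRel_adj, ne_eq, reduceCtorEq, not_false_eq_true, true_and,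
      false_or, or_false, Sum.inl.injEq]
    exact eq_comm
  · simp only [subdivTwice, fromRel_adj, ne_eq, Sum.inr.injEq, reduceCtorEq, not_false_eq_true,
      true_and, false_or, Sum.inl.injEq]
    exact eq_comm
  · simp [subdivTwice]

theorem subdivTwice_hasThreeNeighbors_iff [Fintype V] (hG : ∀ v, 3 ≤ G.degree v)
    (x : V ⊕ (G.edgeSet ⊕ G.Incidences)) :
    G.subdivTwice.HasThreeNeighbors (fun _ => True) x ↔ IsVertexPoint x := by
  rcases x with v | e | i
  · obtain ⟨a, b, c, hab, hac, hbc, ha, hb, hc⟩ := exists_three_incidences_of_vertex (hG v)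
    simp only [IsVertexPoint, iff_true]
    refine ⟨.inr (.inr a), .inr (.inr b), .inr (.inr c), ?_⟩
    simp [*, subdivTwice]
  · simp only [IsVertexPoint, iff_false]
    rintro ⟨_, _, _, hab, hac, hbc, ⟨ha, hb, hc⟩, -⟩
    obtain ⟨a, rfl, hae⟩ := (subdivTwice_adj_edge_iff _ _).1 ha
    obtain ⟨b, rfl, hbe⟩ := (subdivTwice_adj_edge_iff _ _).1 hb
    obtain ⟨c, rfl, hce⟩ := (subdivTwice_adj_edge_iff _ _).1 hc
    exact not_three_incidences_of_edge (by simpa using hab) (by simpa using hac)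
      (by simpa using hbc) hae hbe hce
  · simp only [IsVertexPoint, iff_false]
    rintro ⟨a, b, c, hab, hac, hbc, ⟨ha, hb, hc⟩, -⟩
    rw [subdivTwice_adj_incidence_iff] at ha hb hc
    grind

theorem isIncidencePoint_iff_subdivTwice (x : V ⊕ (G.edgeSet ⊕ G.Incidences)) :
    IsIncidencePoint x ↔ ∃ y, G.subdivTwice.Adj x y ∧ IsVertexPoint y := by
  rcases x with v | e | i <;> simp [subdivTwice, IsVertexPoint, IsIncidencePoint]

theorem gThree_hasThreeNeighbors_iff [Fintype V] (hG : ∀ v, 3 ≤ G.degree v)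
    (x : V ⊕ (G.edgeSet ⊕ G.Incidences)) :
    G.gThree.HasThreeNeighbors (fun _ => True) x ↔ ¬ IsIncidencePoint x := by
  rcases x with v | e | i
  · obtain ⟨a, b, c, hab, hac, hbc, ha, hb, hc⟩ := exists_three_incidences_of_vertex (hG v)
    simp only [IsIncidencePoint, not_false_eq_true, iff_true]
    refine ⟨.inr (.inr a), .inr (.inr b), .inr (.inr c), ?_⟩
    simp [*, gThree, subdivTwice]
  · obtain ⟨a, b, hab, ha, hb⟩ := exists_two_incidences_of_edge e
    simp only [IsIncidencePoint, not_false_eq_true, iff_true]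
    refine ⟨.inr (.inr a), .inr (.inr b), .inl a.1.1, ?_⟩
    simp [*, gThree, subdivTwice]
  · simp only [IsIncidencePoint, not_true_eq_false, iff_false]
    rintro ⟨a, b, c, hab, hac, hbc, ⟨ha, hb, hc⟩, -⟩
    simp only [gThree_adj_iff, subdivTwice_adj_incidence_iff, IsVertexPoint, IsEdgePoint,
      false_and, or_false] at ha hb hc
    grind

theorem gThree_hasThreeNeighbors_isIncidencePoint_iff [Fintype V] (hG : ∀ v, 3 ≤ G.degree v)
    (x : V ⊕ (G.edgeSet ⊕ G.Incidences)) :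
    G.gThree.HasThreeNeighbors IsIncidencePoint x ↔ IsVertexPoint x := by
  rcases x with v | e | i
  · obtain ⟨a, b, c, hab, hac, hbc, ha, hb, hc⟩ := exists_three_incidences_of_vertex (hG v)
    simp only [IsVertexPoint, iff_true]
    refine ⟨.inr (.inr a), .inr (.inr b), .inr (.inr c), ?_⟩
    simp [*, gThree, subdivTwice, IsIncidencePoint]
  · simp only [IsVertexPoint, iff_false]
    have key : ∀ y, G.gThree.Adj (.inr (.inl e)) y → IsIncidencePoint y →
        ∃ i : G.Incidences, y = .inr (.inr i) ∧ i.1.2 = e := by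
      rintro (w | f | j) <;> simp [gThree, subdivTwice, IsIncidencePoint]
    rintro ⟨_, _, _, hab, hac, hbc, ⟨ha, hb, hc⟩, pa, pb, pc⟩
    obtain ⟨a, rfl, hae⟩ := key _ ha pa
    obtain ⟨b, rfl, hbe⟩ := key _ hb pb
    obtain ⟨c, rfl, hce⟩ := key _ hc pc
    exact not_three_incidences_of_edge (by simpa using hab) (by simpa using hac)
      (by simpa using hbc) hae hbe hce
  · simp only [IsVertexPoint, iff_false]
    rintro ⟨a | a | a, -, -, -, -, -, ⟨ha, -, -⟩, pa, -, -⟩ <;>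
      simp [gThree, subdivTwice, IsIncidencePoint] at ha pa

end SimpleGraph

/-- For finite connected graphs `G`, `H` of minimum degree at least `3`,
`G2 ≅ H2` iff `G3 ≅ H3`. -/
theorem stmt1 {V W : Type*} [Fintype V] [Fintype W]
    (G : SimpleGraph V) (H : SimpleGraph W)
    (hGc : G.Connected) (hHc : H.Connected)
    (hGd : ∀ v, 3 ≤ G.degree v) (hHd : ∀ w, 3 ≤ H.degree w) :
    Nonempty (G.subdivTwice ≃g H.subdivTwice) ↔ Nonempty (G.gThree ≃g H.gThree) := by
  constructor
  · rintro ⟨φ⟩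
    have hV (x) : IsVertexPoint (φ x) ↔ IsVertexPoint x := by
      rw [← subdivTwice_hasThreeNeighbors_iff hGd, ← subdivTwice_hasThreeNeighbors_iff hHd]
      exact φ.hasThreeNeighbors_iff (fun _ => Iff.rfl) x
    have hI (x) : IsIncidencePoint (φ x) ↔ IsIncidencePoint x := by
      simp only [isIncidencePoint_iff_subdivTwice, φ.surjective.exists, hV, φ.map_adj_iff]
    have hE (x) : IsEdgePoint (φ x) ↔ IsEdgePoint x := by
      simp only [isEdgePoint_iff, hV, hI]
    exact ⟨φ.toEquiv, fun {x y} => by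
      simpa [gThree_adj_iff, hV, hE] using or_congr_left φ.map_adj_iff⟩
  · rintro ⟨φ⟩
    have hI (x) : IsIncidencePoint (φ x) ↔ IsIncidencePoint x := by
      rw [← not_iff_not, ← gThree_hasThreeNeighbors_iff hGd, ← gThree_hasThreeNeighbors_iff hHd]
      exact φ.hasThreeNeighbors_iff (fun _ => Iff.rfl) x
    have hV (x) : IsVertexPoint (φ x) ↔ IsVertexPoint x := by
      rw [← gThree_hasThreeNeighbors_isIncidencePoint_iff hGd,
        ← gThree_hasThreeNeighbors_isIncidencePoint_iff hHd]
      exact φ.hasThreeNeighbors_iff hI x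
    have hE (x) : IsEdgePoint (φ x) ↔ IsEdgePoint x := by
      simp only [isEdgePoint_iff, hV, hI]
    exact ⟨φ.toEquiv, fun {x y} => by
      rw [subdivTwice_adj_iff, subdivTwice_adj_iff]
      exact and_congr φ.map_adj_iff (not_congr (by
        simp only [RelIso.coe_fn_toEquiv, hV, hE]))⟩
end

section
/- Let G and H be finite connected simple graphs, each of minimum degree at least 3. Then G and H are isomorphic if and only if G2 and H2 are isomorphic. -/
open SimpleGraph
open scoped Classical

namespace SimpleGraph

variable {V W : Type*} {G : SimpleGraph V} {H : SimpleGraph W}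

lemma subdivTwice_adj_inl {v : V} {x : V ⊕ (G.edgeSet ⊕ G.Incidences)} :
    G.subdivTwice.Adj (Sum.inl v) x ↔
      ∃ i : G.Incidences, i.val.1 = v ∧ x = Sum.inr (Sum.inr i) := by
  rcases x with w | e | i <;> simp [subdivTwice]

lemma subdivTwice_adj_edge {e : G.edgeSet} {x : V ⊕ (G.edgeSet ⊕ G.Incidences)} :
    G.subdivTwice.Adj (Sum.inr (Sum.inl e)) x ↔
      ∃ i : G.Incidences, i.val.2 = e ∧ x = Sum.inr (Sum.inr i) := by
  rcases x with w | e | i <;> simp [subdivTwice]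

lemma subdivTwice_adj_incidence {i : G.Incidences} {x : V ⊕ (G.edgeSet ⊕ G.Incidences)} :
    G.subdivTwice.Adj (Sum.inr (Sum.inr i)) x ↔
      x = Sum.inl i.val.1 ∨ x = Sum.inr (Sum.inl i.val.2) := by
  rcases x with w | e | j
  · rw [adj_comm, subdivTwice_adj_inl]
    simp [eq_comm (a := w)]
  · rw [adj_comm, subdivTwice_adj_edge]
    simp [eq_comm (a := e)]
  · simp [subdivTwice]

/-- A vertex with at least three neighbours. -/
def IsBranch (G : SimpleGraph V) (x : V) : Prop :=
  ∃ a b c, a ≠ b ∧ a ≠ c ∧ b ≠ c ∧ G.Adj x a ∧ G.Adj x b ∧ G.Adj x c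

lemma IsBranch.map {x : V} (hx : G.IsBranch x) (φ : G ≃g H) : H.IsBranch (φ x) := by
  obtain ⟨a, b, c, hab, hac, hbc, ha, hb, hc⟩ := hx
  exact ⟨φ a, φ b, φ c, φ.injective.ne hab, φ.injective.ne hac, φ.injective.ne hbc,
    φ.map_adj_iff.2 ha, φ.map_adj_iff.2 hb, φ.map_adj_iff.2 hc⟩

lemma isBranch_subdivTwice_inl {v : V} (hv : G.IsBranch v) :
    G.subdivTwice.IsBranch (Sum.inl v) := by
  obtain ⟨a, b, c, hab, hac, hbc, ha, hb, hc⟩ := hv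
  refine ⟨Sum.inr (Sum.inr ⟨(v, ⟨s(v, a), ha⟩), by simp⟩),
    Sum.inr (Sum.inr ⟨(v, ⟨s(v, b), hb⟩), by simp⟩),
    Sum.inr (Sum.inr ⟨(v, ⟨s(v, c), hc⟩), by simp⟩), ?_, ?_, ?_, ?_, ?_, ?_⟩
  · simpa [Subtype.ext_iff, Sym2.congr_right, -Sym2.eq, -Sym2.rel_iff'] using hab
  · simpa [Subtype.ext_iff, Sym2.congr_right, -Sym2.eq, -Sym2.rel_iff'] using hac
  · simpa [Subtype.ext_iff, Sym2.congr_right, -Sym2.eq, -Sym2.rel_iff'] using hbc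
  all_goals exact subdivTwice_adj_inl.2 ⟨_, rfl, rfl⟩

lemma IsBranch.eq_inl {x : V ⊕ (G.edgeSet ⊕ G.Incidences)}
    (hx : G.subdivTwice.IsBranch x) : ∃ v, x = Sum.inl v := by
  obtain ⟨a, b, c, hab, hac, hbc, ha, hb, hc⟩ := hx
  rcases x with v | ⟨⟨e, he⟩⟩ | i
  · exact ⟨v, rfl⟩
  · obtain ⟨⟨⟨u, e₁⟩, hu⟩, rfl, rfl⟩ := subdivTwice_adj_edge.1 ha
    obtain ⟨⟨⟨v, e₂⟩, hv⟩, h₂, rfl⟩ := subdivTwice_adj_edge.1 hb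
    obtain ⟨⟨⟨w, e₃⟩, hw⟩, h₃, rfl⟩ := subdivTwice_adj_edge.1 hc
    dsimp only at *
    subst h₂ h₃
    induction e with
    | _ p q => simp only [Sym2.mem_iff] at hu hv hw; grind
  · rw [subdivTwice_adj_incidence] at ha hb hc
    grind

lemma adj_iff_subdivTwice {u v : V} :
    G.Adj u v ↔ u ≠ v ∧ ∃ a b c, G.subdivTwice.Adj (Sum.inl u) a ∧
      G.subdivTwice.Adj a b ∧ G.subdivTwice.Adj b c ∧ G.subdivTwice.Adj c (Sum.inl v) := by
  constructor
  · intro h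
    refine ⟨h.ne, Sum.inr (Sum.inr ⟨(u, ⟨s(u, v), h⟩), by simp⟩),
      Sum.inr (Sum.inl ⟨s(u, v), h⟩), Sum.inr (Sum.inr ⟨(v, ⟨s(u, v), h⟩), by simp⟩), ?_⟩
    simp [subdivTwice_adj_inl, subdivTwice_adj_edge, subdivTwice_adj_incidence]
  · rintro ⟨huv, a, b, c, ha, hb, hc, hd⟩
    obtain ⟨i, rfl, rfl⟩ := subdivTwice_adj_inl.1 ha
    obtain ⟨j, rfl, rfl⟩ := subdivTwice_adj_inl.1 hd.symm
    obtain rfl | rfl := subdivTwice_adj_incidence.1 hb <;>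
      obtain h | h := subdivTwice_adj_incidence.1 hc.symm
    · exact absurd (Sum.inl_injective h) huv
    · simp at h
    · simp at h
    · have h' : i.val.2 = j.val.2 := Sum.inl_injective (Sum.inr_injective h)
      have he : (i.val.2 : Sym2 V) = s(i.val.1, j.val.1) :=
        (Sym2.mem_and_mem_iff huv).1 ⟨i.2, h' ▸ j.2⟩
      rw [← mem_edgeSet, ← he]
      exact i.val.2.2

/-- An isomorphism of graphs induces a bijection between their incidences. -/
noncomputable def Iso.mapIncidences (φ : G ≃g H) : G.Incidences ≃ H.Incidences :=
  (φ.toEquiv.prodCongr φ.mapEdgeSet).subtypeEquiv fun ⟨v, ⟨e, he⟩⟩ => by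
    simp [Iso.mapEdgeSet, Hom.mapEdgeSet, Sym2.mem_map]

/-- An isomorphism of graphs induces an isomorphism of their double subdivisions. -/
noncomputable def Iso.subdivTwice (φ : G ≃g H) : G.subdivTwice ≃g H.subdivTwice where
  toEquiv := φ.toEquiv.sumCongr (φ.mapEdgeSet.sumCongr φ.mapIncidences)
  map_rel_iff' {x y} := by
    rcases x with u | e | i <;> rcases y with v | f | j <;>
      simp [SimpleGraph.subdivTwice, Iso.mapIncidences, -Iso.mapEdgeSet_apply]

lemma isBranch_of_three_le_degree [Fintype V] [DecidableRel G.Adj] {v : V}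
    (hv : 3 ≤ G.degree v) : G.IsBranch v := by
  obtain ⟨a, b, c, ha, hb, hc, hab, hac, hbc⟩ := Finset.two_lt_card_iff.1 hv
  simp only [mem_neighborFinset] at ha hb hc
  exact ⟨a, b, c, hab, hac, hbc, ha, hb, hc⟩

lemma nonempty_iso_of_subdivTwice (hG : ∀ v, G.IsBranch v) (hH : ∀ w, H.IsBranch w)
    (φ : G.subdivTwice ≃g H.subdivTwice) : Nonempty (G ≃g H) := by
  choose f hf using fun v => ((isBranch_subdivTwice_inl (hG v)).map φ).eq_inl
  choose g hg using fun w => ((isBranch_subdivTwice_inl (hH w)).map φ.symm).eq_inl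
  refine ⟨⟨⟨f, g, fun v => ?_, fun w => ?_⟩, fun {u v} => ?_⟩⟩
  · apply Sum.inl_injective (β := G.edgeSet ⊕ G.Incidences)
    rw [← hg, ← hf, φ.symm_apply_apply]
  · apply Sum.inl_injective (β := H.edgeSet ⊕ H.Incidences)
    rw [← hf, ← hg, φ.apply_symm_apply]
  · have hne : f u ≠ f v ↔ u ≠ v := by
      rw [← (Sum.inl_injective (β := H.edgeSet ⊕ H.Incidences)).ne_iff, ← hf, ← hf,
        φ.injective.ne_iff, Sum.inl_injective.ne_iff]
    rw [Equiv.coe_fn_mk, adj_iff_subdivTwice, adj_iff_subdivTwice, hne]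
    simp only [← hf, φ.surjective.exists, φ.map_adj_iff]

end SimpleGraph

/-- For finite connected graphs `G`, `H` of minimum degree at least `3`,
`G ≅ H` iff `G2 ≅ H2`. -/
theorem stmt2 {V W : Type*} [Fintype V] [Fintype W]
    (G : SimpleGraph V) (H : SimpleGraph W)
    (hGc : G.Connected) (hHc : H.Connected)
    (hGd : ∀ v, 3 ≤ G.degree v) (hHd : ∀ w, 3 ≤ H.degree w) :
    Nonempty (G ≃g H) ↔ Nonempty (G.subdivTwice ≃g H.subdivTwice) := by
  constructor
  · rintro ⟨φ⟩
    exact ⟨φ.subdivTwice⟩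
  · rintro ⟨φ⟩
    exact nonempty_iso_of_subdivTwice (fun v => isBranch_of_three_le_degree (hGd v))
      (fun w => isBranch_of_three_le_degree (hHd w)) φ
end

section
/- If a finite simple graph G is a disjoint union of stars, then the complement of G is a proper circular-arc graph. -/
open SimpleGraph
open scoped Classical

/-- In a graph whose edges each have an endpoint of degree one, the vertices can be assigned
centers such that the edges are exactly the pairs of a center and a different vertex assigned
to it. -/
theorem SimpleGraph.exists_center_of_degree_eq_one {W : Type*} [Fintype W] (G : SimpleGraph W)
    (h : ∀ u w, G.Adj u w → G.degree u = 1 ∨ G.degree w = 1) :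
    ∃ c : W → W, ∀ u w, G.Adj u w ↔
      (c u = u ∧ c w = u ∧ u ≠ w) ∨ (c w = w ∧ c u = w ∧ w ≠ u) := by
  have uniq : ∀ v, G.degree v = 1 → ∀ a b, G.Adj v a → G.Adj v b → a = b := fun v hv a b ha hb =>
    (G.degree_eq_one_iff_existsUnique_adj.1 hv).unique ha hb
  let e := Fintype.equivFin W
  let isCenter : W → Prop := fun v =>
    ∀ w, G.Adj v w → G.degree w = 1 ∧ (G.degree v = 1 → e v < e w)
  have nbr : ∀ v, ¬ isCenter v → G.degree v = 1 ∧ ∃ w, G.Adj v w := by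
    intro v hv
    obtain ⟨w, hw, hvw⟩ : ∃ w, G.Adj v w ∧ ¬ (G.degree w = 1 ∧ (G.degree v = 1 → e v < e w)) := by
      simpa [isCenter] using hv
    refine ⟨?_, w, hw⟩
    by_contra h1
    exact hvw ⟨(h v w hw).resolve_left h1, fun h2 => absurd h2 h1⟩
  have one : ∀ u w, G.Adj u w → (isCenter u ↔ ¬ isCenter w) := by
    intro u w huw
    constructor
    · intro hu hw
      have h1 := hu w huw
      have h2 := hw u huw.symm
      exact lt_asymm (h1.2 h2.1) (h2.2 h1.1)
    · intro hw v huv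
      obtain ⟨hw1, -⟩ := nbr w hw
      by_cases hu1 : G.degree u = 1
      · obtain rfl := uniq u hu1 v w huv huw
        refine ⟨hw1, fun _ => ?_⟩
        by_contra hlt
        refine hw fun x hx => ?_
        obtain rfl := uniq v hw1 x u hx huw.symm
        exact ⟨hu1, fun _ => lt_of_le_of_ne (not_lt.1 hlt) fun he => huw.ne (e.injective he).symm⟩
      · exact ⟨(h u v huv).resolve_left hu1, fun h2 => absurd h2 hu1⟩
  have hc : ∀ v, ∃ x, (isCenter v ∧ x = v) ∨ (¬ isCenter v ∧ G.Adj v x) := by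
    intro v
    by_cases hv : isCenter v
    · exact ⟨v, Or.inl ⟨hv, rfl⟩⟩
    · obtain ⟨x, hx⟩ := (nbr v hv).2
      exact ⟨x, Or.inr ⟨hv, hx⟩⟩
  choose c hc using hc
  have of_center : ∀ u w, G.Adj u w → isCenter u → c u = u ∧ c w = u ∧ u ≠ w := by
    intro u w huw hu
    have hw := (one u w huw).1 hu
    exact ⟨((hc u).resolve_right fun hn => hn.1 hu).2,
      uniq w (nbr w hw).1 _ _ ((hc w).resolve_left fun hn => hw hn.1).2 huw.symm, huw.ne⟩
  have adj_of : ∀ u w, c w = u → u ≠ w → G.Adj u w := by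
    rintro u w rfl hne
    exact ((hc w).resolve_left fun hn => hne hn.2).2.symm
  refine ⟨c, fun u w => ⟨fun huw => ?_, ?_⟩⟩
  · by_cases hu : isCenter u
    · exact Or.inl (of_center u w huw hu)
    · exact Or.inr (of_center w u huw.symm (by_contra fun hw => hu ((one u w huw).2 hw)))
  · rintro (⟨-, h1, h2⟩ | ⟨-, h1, h2⟩)
    · exact adj_of u w h1 h2
    · exact (adj_of w u h1 h2).symm

/-- The arc `{a, a + 1, …, a + m}` in `ZMod n`. -/
def circularArc (n m a : ℕ) : Set (ZMod n) :=
  {x | ∃ j : ℕ, j ≤ m ∧ x = (a : ZMod n) + (j : ZMod n)}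

theorem ncard_circularArc {n m : ℕ} (hm : m < n) (a : ℕ) :
    (circularArc n m a).ncard = m + 1 := by
  have himage : circularArc n m a =
      (fun j : ℕ => (a : ZMod n) + (j : ZMod n)) '' (Finset.range (m + 1) : Set ℕ) := by
    ext x
    simp [circularArc, eq_comm]
  rw [himage, Set.InjOn.ncard_image, Set.ncard_coe_finset, Finset.card_range]
  intro i hi j hj hij
  have hi' : i < m + 1 := by simpa using hi
  have hj' : j < m + 1 := by simpa using hj
  have hmod := (ZMod.natCast_eq_natCast_iff' i j n).1 (add_left_cancel hij)
  rwa [Nat.mod_eq_of_lt (by omega), Nat.mod_eq_of_lt (by omega)] at hmod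

/-- Two half-circles are disjoint exactly when they are antipodal. -/
theorem circularArc_inter_nonempty_iff {m a b : ℕ} (ha : a < 2 * (m + 1)) (hb : b < 2 * (m + 1)) :
    (circularArc (2 * (m + 1)) m a ∩ circularArc (2 * (m + 1)) m b).Nonempty ↔
      ¬ (a + (m + 1) = b ∨ b + (m + 1) = a) := by
  wlog hab : a ≤ b generalizing a b
  · rw [Set.inter_comm, this hb ha (by omega), or_comm]
  constructor
  · rintro ⟨x, ⟨i, hi, rfl⟩, ⟨j, hj, hij⟩⟩ hanti
    obtain rfl : a + (m + 1) = b := by omega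
    have hcast : ((i : ℕ) : ZMod (2 * (m + 1))) = ((m + 1 + j : ℕ) : ZMod (2 * (m + 1))) := by
      apply add_left_cancel (a := (a : ZMod (2 * (m + 1))))
      rw [hij]
      push_cast
      ring
    rw [ZMod.natCast_eq_natCast_iff', Nat.mod_eq_of_lt (by omega),
      Nat.mod_eq_of_lt (by omega)] at hcast
    omega
  · intro hanti
    by_cases hlt : b < a + (m + 1)
    · refine ⟨(b : ZMod (2 * (m + 1))), ⟨b - a, by omega, ?_⟩, ⟨0, by omega, by simp⟩⟩
      rw [← Nat.cast_add, Nat.add_sub_cancel' hab]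
    · refine ⟨(a : ZMod (2 * (m + 1))), ⟨0, by omega, by simp⟩,
        ⟨a + 2 * (m + 1) - b, by omega, ?_⟩⟩
      rw [← Nat.cast_add, Nat.add_sub_cancel' (by omega), Nat.cast_add, ZMod.natCast_self, add_zero]

/-- if `G` is a disjoint union of stars, then the complement of `G` is a
proper circular-arc graph. -/
theorem stmt5 {W : Type*} [Fintype W] (G : SimpleGraph W)
    (h : IsDisjointUnionOfStars G) :
    IsProperCircularArcGraph Gᶜ := by
  obtain ⟨c, hc⟩ := G.exists_center_of_degree_eq_one h.2
  let e := Fintype.equivFin W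
  let m := Fintype.card W
  let p : W → ℕ := fun v => (e (c v) : ℕ) + if c v = v then 0 else m + 1
  have he : ∀ v, (e v : ℕ) < m := fun v => (e v).isLt
  have hp : ∀ v, p v < 2 * (m + 1) := by
    intro v
    have := he (c v)
    dsimp only [p]
    split_ifs <;> omega
  have hanti : ∀ u w, p u + (m + 1) = p w ↔ c u = u ∧ c w = u ∧ u ≠ w := by
    intro u w
    have h1 := he (c u)
    have h2 := he (c w)
    constructor
    · intro hpw
      dsimp only [p] at hpw
      split_ifs at hpw with hu hw hw
      · omega
      · have hcc : c u = c w := e.injective (Fin.ext (by omega))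
        rw [hu] at hcc
        exact ⟨hu, hcc.symm, fun huw => hw (huw ▸ hu)⟩
      · omega
      · omega
    · rintro ⟨hu, hw, hne⟩
      simp [p, hu, hw, hne]
  refine ⟨2 * (m + 1), by omega, fun v => circularArc (2 * (m + 1)) m (p v),
    fun v => ⟨p v, m, rfl⟩, fun u w huw => ?_, fun u w _ hss => ?_⟩
  · rw [circularArc_inter_nonempty_iff (hp u) (hp w), hanti, hanti, ← hc,
      SimpleGraph.compl_adj, and_iff_right huw]
  · have hlt := Set.ncard_lt_ncard hss (Set.toFinite _)
    rw [ncard_circularArc (by omega), ncard_circularArc (by omega)] at hlt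
    exact lt_irrefl _ hlt
end

section
/- Let G be a finite connected simple graph with at least one edge. Then the induced subgraph of G' on V ∪ V2 is a proper circular-arc graph, and the induced subgraph of G' on V1 ∪ V2 is a proper circular-arc graph. -/
open SimpleGraph
open scoped Classical

/-- The `m` consecutive residues starting at `a` form a circular arc in `ZMod (2 * m)`. -/
theorem isCircularArc_setOf_val_sub_lt {m : ℕ} (hm : 1 ≤ m) (a : ZMod (2 * m)) :
    IsCircularArc {x : ZMod (2 * m) | (x - a).val < m} := by
  have : NeZero (2 * m) := ⟨by omega⟩
  refine ⟨a, m - 1, Set.ext fun x => ⟨fun hx => ⟨(x - a).val, ?_, ?_⟩, ?_⟩⟩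
  · exact Nat.le_sub_one_of_lt hx
  · rw [ZMod.natCast_zmod_val, add_sub_cancel]
  · rintro ⟨j, hj, rfl⟩
    rw [Set.mem_ofPred_eq, add_sub_cancel_left, ZMod.val_natCast_of_lt (by omega)]
    omega

/-- Two half-circle arcs are disjoint exactly when they are antipodal. -/
theorem halfArc_inter_nonempty_iff {m : ℕ} (hm : 1 ≤ m) (a b : ZMod (2 * m)) :
    ({x : ZMod (2 * m) | (x - a).val < m} ∩ {x | (x - b).val < m}).Nonempty ↔
      b ≠ a + (m : ZMod (2 * m)) := by
  have : NeZero (2 * m) := ⟨by omega⟩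
  have hmval : (m : ZMod (2 * m)).val = m := ZMod.val_natCast_of_lt (by omega)
  constructor
  · rintro ⟨x, hxa, hxb⟩ rfl
    simp only [Set.mem_ofPred_eq] at hxa hxb
    have hsum : x - a = (x - (a + m)) + m := by ring
    rw [hsum, ZMod.val_add_of_lt (by omega)] at hxa
    omega
  · intro hne
    have hval : (b - a).val ≠ m := fun h => hne <| by
      rw [← sub_eq_iff_eq_add', ← ZMod.natCast_zmod_val (b - a), h]
    rcases lt_or_gt_of_ne hval with h | h
    · exact ⟨b, h, by simpa using Nat.lt_of_succ_le hm⟩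
    · have hba : b - a ≠ 0 := by
        intro h0
        simp [h0] at h
      have : NeZero (b - a) := ⟨hba⟩
      refine ⟨a, by simpa using Nat.lt_of_succ_le hm, ?_⟩
      rw [Set.mem_ofPred_eq, ← neg_sub, ZMod.val_neg_of_ne_zero]
      have := ZMod.val_lt (b - a)
      omega

/-- The complement of a disjoint union of complete bipartite graphs is a proper circular-arc
graph; `c` gives the component of a vertex and `s` its side. -/
theorem isProperCircularArcGraph_of_adj_iff {W C : Type*} [Finite C] [Nonempty C]
    (H : SimpleGraph W) (c : W → C) (s : W → Bool)
    (hadj : ∀ u w, u ≠ w → (H.Adj u w ↔ ¬ (c u = c w ∧ s u ≠ s w))) :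
    IsProperCircularArcGraph H := by
  obtain ⟨m, ⟨φ⟩⟩ := Finite.exists_equiv_fin C
  have hm : 1 ≤ m := (φ (Classical.arbitrary C)).pos
  have : NeZero (2 * m) := ⟨by omega⟩
  let p : W → ZMod (2 * m) := fun w => ((φ (c w) + if s w then m else 0 : ℕ) : ZMod (2 * m))
  have hp : ∀ u w, p w = p u + m ↔ c u = c w ∧ s u ≠ s w := by
    intro u w
    have hu := (φ (c u)).isLt
    have hw := (φ (c w)).isLt
    rw [← φ.injective.eq_iff, Fin.ext_iff]
    simp only [p]
    rw [← Nat.cast_add, ZMod.natCast_eq_natCast_iff']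
    rw [Nat.mod_eq_of_lt (a := φ (c w) + _) (by split_ifs <;> omega)]
    cases s u <;> cases s w <;>
      simp only [if_true, if_false, Bool.false_eq_true, ne_eq, not_true_eq_false, and_false,
        reduceCtorEq, not_false_eq_true, and_true, iff_false]
    · rw [Nat.mod_eq_of_lt (by omega)]; omega
    · rw [Nat.mod_eq_of_lt (by omega)]; omega
    · rw [show (φ (c u) : ℕ) + m + m = φ (c u) + 2 * m by ring, Nat.add_mod_right,
        Nat.mod_eq_of_lt (by omega)]
      omega
    · rw [show (φ (c u) : ℕ) + m + m = φ (c u) + 2 * m by ring, Nat.add_mod_right,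
        Nat.mod_eq_of_lt (by omega)]
      omega
  refine ⟨2 * m, by omega, fun w => {x | (x - p w).val < m},
    fun v => isCircularArc_setOf_val_sub_lt hm _, fun u w huw => ?_, fun u w _ hss => ?_⟩
  · rw [hadj u w huw, halfArc_inter_nonempty_iff hm, ne_eq (p w), hp]
  · have hpos : p u = p w := by
      by_contra hne
      obtain ⟨x, hxu, hxw⟩ := (halfArc_inter_nonempty_iff hm (p u) (p w + m)).2
        fun h => hne (add_right_cancel h).symm
      exact (halfArc_inter_nonempty_iff hm (p w) (p w + m)).1 ⟨x, hss.1 hxu, hxw⟩ rfl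
    simp [hpos] at hss

/-- for a finite connected graph `G` with at least one edge, the induced
subgraphs of `G'` on `V ∪ V2` and on `V1 ∪ V2` are proper circular-arc graphs. -/
theorem stmt8 {V : Type*} [Fintype V] (G : SimpleGraph V)
    (hc : G.Connected) (he : G.edgeSet.Nonempty) :
    IsProperCircularArcGraph ((G.gPrime).induce
      (Set.range (Sum.inl : V → V ⊕ (G.edgeSet ⊕ G.Incidences)) ∪
       Set.range (fun i : G.Incidences => Sum.inr (Sum.inr i)))) ∧
    IsProperCircularArcGraph ((G.gPrime).induce
      (Set.range (fun e : G.edgeSet =>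
         (Sum.inr (Sum.inl e) : V ⊕ (G.edgeSet ⊕ G.Incidences))) ∪
       Set.range (fun i : G.Incidences => Sum.inr (Sum.inr i)))) := by
  have := hc.nonempty
  have : Nonempty G.edgeSet := he.to_subtype
  constructor
  · refine isProperCircularArcGraph_of_adj_iff (C := V) _
      (fun x => Sum.elim id (Sum.elim (fun _ => Classical.arbitrary V) fun i => i.val.1) x.val)
      (fun x => x.val.isRight) ?_
    rintro ⟨_, ⟨u, rfl⟩ | ⟨i, rfl⟩⟩ ⟨_, ⟨w, rfl⟩ | ⟨j, rfl⟩⟩ hne <;>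
      rw [Ne, Subtype.ext_iff] at hne <;>
      simp [gPrime, gThree, subdivTwice] at hne ⊢ <;> grind
  · refine isProperCircularArcGraph_of_adj_iff (C := G.edgeSet) _
      (fun x => Sum.elim (fun _ => Classical.arbitrary _) (Sum.elim id fun i => i.val.2) x.val)
      (fun x => Sum.elim (fun _ => false) Sum.isRight x.val) ?_
    rintro ⟨_, ⟨u, rfl⟩ | ⟨i, rfl⟩⟩ ⟨_, ⟨w, rfl⟩ | ⟨j, rfl⟩⟩ hne <;>
      rw [Ne, Subtype.ext_iff] at hne <;>
      simp [gPrime, gThree, subdivTwice] at hne ⊢ <;> grind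
end

section
/- Let G be a finite connected simple graph. Then G' is a proper B-graph, where B is the 5-vertex graph consisting of two triangles with one vertex identified. -/
open SimpleGraph
open scoped Classical

/-- An induced subgraph is connected as soon as every vertex other than a root `r` has a
neighbour of smaller rank. -/
lemma connected_induce_of_rank {W : Type*} (H : SimpleGraph W) (S : Set W) (r : W) (hr : r ∈ S)
    (rank : W → ℕ) (h : ∀ s ∈ S, s ≠ r → ∃ t ∈ S, H.Adj s t ∧ rank t < rank s) :
    (H.induce S).Connected := by
  have key : ∀ (N : ℕ) (s : W) (hs : s ∈ S), rank s = N →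
      (H.induce S).Reachable ⟨s, hs⟩ ⟨r, hr⟩ := by
    intro N
    induction N using Nat.strong_induction_on with
    | _ N ih =>
      intro s hs hN
      by_cases hsr : s = r
      · subst hsr
        exact SimpleGraph.Reachable.refl _
      · obtain ⟨t, ht, hadj, hlt⟩ := h s hs hsr
        have hst : (H.induce S).Adj ⟨s, hs⟩ ⟨t, ht⟩ := hadj
        exact hst.reachable.trans (ih _ (hN ▸ hlt) t ht rfl)
  have : Nonempty S := ⟨⟨r, hr⟩⟩
  exact ⟨fun a b => (key _ a.1 a.2 rfl).trans (key _ b.1 b.2 rfl).symm⟩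

/-- The interval `{i, …, i + k}` in `Fin (2 * k + 2)`, for `i : Fin k`. -/
def centralArc (k : ℕ) (i : Fin k) : Set (Fin (2 * k + 2)) :=
  {x | i.val ≤ x.val ∧ x.val ≤ i.val + k}

lemma start_mem_centralArc {k : ℕ} (i : Fin k) :
    (⟨i.val, by omega⟩ : Fin (2 * k + 2)) ∈ centralArc k i :=
  ⟨le_rfl, Nat.le_add_right _ _⟩

lemma centralArc_subset_iff {k : ℕ} {i j : Fin k} :
    centralArc k i ⊆ centralArc k j ↔ i = j := by
  refine ⟨fun h => ?_, fun h => h ▸ subset_rfl⟩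
  have h₁ := h (start_mem_centralArc i)
  have h₂ := h (show (⟨i.val + k, by omega⟩ : Fin (2 * k + 2)) ∈ centralArc k i from
    ⟨Nat.le_add_right _ _, le_rfl⟩)
  simp only [centralArc, Set.mem_ofPred_eq] at h₁ h₂
  ext
  omega

/-- Any two central arcs contain the point `k`. -/
lemma centralArc_inter_nonempty {k : ℕ} (i j : Fin k) :
    (centralArc k i ∩ centralArc k j).Nonempty := by
  refine ⟨⟨k, by omega⟩, ?_⟩
  simp only [centralArc, Set.mem_inter_iff, Set.mem_ofPred_eq]
  omega

/-- The representation of `G'` in `B(2p+2, 2q+2)`, relative to indexings of the vertices and of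
the edges of `G`: vertices are central arcs of the first cycle, edges are central arcs of the
second one, and the incidence `(v, e)` is the complement of the arcs of `v` and `e`. -/
def gPrimeRep {V : Type*} (G : SimpleGraph V) {p q : ℕ} (a : V → Fin p) (b : G.edgeSet → Fin q) :
    V ⊕ (G.edgeSet ⊕ G.Incidences) →
      Set (Unit ⊕ (Fin (2 * p + 2) ⊕ Fin (2 * q + 2)))
  | Sum.inl v => {z | ∃ x ∈ centralArc p (a v), z = Sum.inr (Sum.inl x)}
  | Sum.inr (Sum.inl e) => {z | ∃ y ∈ centralArc q (b e), z = Sum.inr (Sum.inr y)}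
  | Sum.inr (Sum.inr i) => {z | (∀ x ∈ centralArc p (a i.1.1), z ≠ Sum.inr (Sum.inl x)) ∧
      ∀ y ∈ centralArc q (b i.1.2), z ≠ Sum.inr (Sum.inr y)}

section

variable {V : Type*} (G : SimpleGraph V) {p q : ℕ} (a : V → Fin p) (b : G.edgeSet → Fin q)

@[simp] lemma inl_notMem_gPrimeRep_vertex (v : V) (c : Unit) :
    Sum.inl c ∉ gPrimeRep G a b (Sum.inl v) := by
  simp [gPrimeRep]

@[simp] lemma fst_mem_gPrimeRep_vertex (v : V) (x : Fin (2 * p + 2)) :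
    Sum.inr (Sum.inl x) ∈ gPrimeRep G a b (Sum.inl v) ↔ x ∈ centralArc p (a v) := by
  simp [gPrimeRep]

@[simp] lemma snd_notMem_gPrimeRep_vertex (v : V) (y : Fin (2 * q + 2)) :
    Sum.inr (Sum.inr y) ∉ gPrimeRep G a b (Sum.inl v) := by
  simp [gPrimeRep]

@[simp] lemma inl_notMem_gPrimeRep_edge (e : G.edgeSet) (c : Unit) :
    Sum.inl c ∉ gPrimeRep G a b (Sum.inr (Sum.inl e)) := by
  simp [gPrimeRep]

@[simp] lemma fst_notMem_gPrimeRep_edge (e : G.edgeSet) (x : Fin (2 * p + 2)) :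
    Sum.inr (Sum.inl x) ∉ gPrimeRep G a b (Sum.inr (Sum.inl e)) := by
  simp [gPrimeRep]

@[simp] lemma snd_mem_gPrimeRep_edge (e : G.edgeSet) (y : Fin (2 * q + 2)) :
    Sum.inr (Sum.inr y) ∈ gPrimeRep G a b (Sum.inr (Sum.inl e)) ↔ y ∈ centralArc q (b e) := by
  simp [gPrimeRep]

@[simp] lemma inl_mem_gPrimeRep_incidence (i : G.Incidences) (c : Unit) :
    Sum.inl c ∈ gPrimeRep G a b (Sum.inr (Sum.inr i)) := by
  simp [gPrimeRep]

@[simp] lemma fst_mem_gPrimeRep_incidence (i : G.Incidences) (x : Fin (2 * p + 2)) :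
    Sum.inr (Sum.inl x) ∈ gPrimeRep G a b (Sum.inr (Sum.inr i)) ↔
      x ∉ centralArc p (a i.1.1) := by
  simp only [gPrimeRep, Set.mem_ofPred_eq]
  aesop

@[simp] lemma snd_mem_gPrimeRep_incidence (i : G.Incidences) (y : Fin (2 * q + 2)) :
    Sum.inr (Sum.inr y) ∈ gPrimeRep G a b (Sum.inr (Sum.inr i)) ↔
      y ∉ centralArc q (b i.1.2) := by
  simp only [gPrimeRep, Set.mem_ofPred_eq]
  aesop

lemma gPrimeRep_nonempty (u : V ⊕ (G.edgeSet ⊕ G.Incidences)) : (gPrimeRep G a b u).Nonempty := by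
  rcases u with v | e | i
  · exact ⟨_, (fst_mem_gPrimeRep_vertex G a b v _).2 (start_mem_centralArc (a v))⟩
  · exact ⟨_, (snd_mem_gPrimeRep_edge G a b e _).2 (start_mem_centralArc (b e))⟩
  · exact ⟨_, inl_mem_gPrimeRep_incidence G a b i ()⟩

lemma gPrimeRep_connected (u : V ⊕ (G.edgeSet ⊕ G.Incidences)) :
    ((BGraph (2 * p + 2) (2 * q + 2)).induce (gPrimeRep G a b u)).Connected := by
  rcases u with v | e | i
  · refine connected_induce_of_rank _ _ _
      ((fst_mem_gPrimeRep_vertex G a b v _).2 (start_mem_centralArc (a v)))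
      (Sum.elim 0 (Sum.elim Fin.val 0)) ?_
    rintro (c | x | y) hs hne
    · simp at hs
    · simp only [fst_mem_gPrimeRep_vertex, centralArc, Set.mem_ofPred_eq] at hs
      have hx : x.val ≠ (a v).val := fun h => hne (by simp [Fin.ext_iff, h])
      refine ⟨Sum.inr (Sum.inl ⟨x.val - 1, by omega⟩), ?_, ?_, ?_⟩
      · simp only [fst_mem_gPrimeRep_vertex, centralArc, Set.mem_ofPred_eq]
        omega
      · simp only [BGraph, fromRel_adj, ne_eq, Sum.inr.injEq, Sum.inl.injEq, Fin.ext_iff]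
        omega
      · simp only [Sum.elim_inr, Sum.elim_inl]
        omega
    · simp at hs
  · refine connected_induce_of_rank _ _ _
      ((snd_mem_gPrimeRep_edge G a b e _).2 (start_mem_centralArc (b e)))
      (Sum.elim 0 (Sum.elim 0 Fin.val)) ?_
    rintro (c | x | y) hs hne
    · simp at hs
    · simp at hs
    · simp only [snd_mem_gPrimeRep_edge, centralArc, Set.mem_ofPred_eq] at hs
      have hy : y.val ≠ (b e).val := fun h => hne (by simp [Fin.ext_iff, h])
      refine ⟨Sum.inr (Sum.inr ⟨y.val - 1, by omega⟩), ?_, ?_, ?_⟩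
      · simp only [snd_mem_gPrimeRep_edge, centralArc, Set.mem_ofPred_eq]
        omega
      · simp only [BGraph, fromRel_adj, ne_eq, Sum.inr.injEq, Fin.ext_iff]
        omega
      · simp only [Sum.elim_inr]
        omega
  · refine connected_induce_of_rank _ _ (Sum.inl ()) (inl_mem_gPrimeRep_incidence G a b i ())
      (Sum.elim 0 (Sum.elim
        (fun x => if x.val < (a i.1.1).val then x.val + 1 else 2 * p + 2 - x.val)
        (fun y => if y.val < (b i.1.2).val then y.val + 1 else 2 * q + 2 - y.val))) ?_
    rintro (c | x | y) hs hne
    · exact absurd rfl hne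
    · simp only [fst_mem_gPrimeRep_incidence, centralArc, Set.mem_ofPred_eq] at hs
      by_cases h₀ : x.val = 0 ∨ x.val = 2 * p + 2 - 1
      · refine ⟨Sum.inl (), by simp, ?_, ?_⟩
        · simpa [BGraph] using h₀
        · simp only [Sum.elim_inr, Sum.elim_inl, Pi.zero_apply]
          split_ifs <;> omega
      · obtain ⟨t, ht⟩ : ∃ t : Fin (2 * p + 2),
            t.val = if x.val < (a i.1.1).val then x.val - 1 else x.val + 1 :=
          ⟨⟨if x.val < (a i.1.1).val then x.val - 1 else x.val + 1, by split_ifs <;> omega⟩, rfl⟩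
        refine ⟨Sum.inr (Sum.inl t), ?_, ?_, ?_⟩
        · simp only [fst_mem_gPrimeRep_incidence, centralArc, Set.mem_ofPred_eq]
          split_ifs at ht <;> omega
        · simp only [BGraph, fromRel_adj, ne_eq, Sum.inr.injEq, Sum.inl.injEq, Fin.ext_iff]
          split_ifs at ht <;> omega
        · simp only [Sum.elim_inr, Sum.elim_inl]
          split_ifs at ht ⊢ <;> omega
    · simp only [snd_mem_gPrimeRep_incidence, centralArc, Set.mem_ofPred_eq] at hs
      by_cases h₀ : y.val = 0 ∨ y.val = 2 * q + 2 - 1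
      · refine ⟨Sum.inl (), by simp, ?_, ?_⟩
        · simpa [BGraph] using h₀
        · simp only [Sum.elim_inr, Sum.elim_inl, Pi.zero_apply]
          split_ifs <;> omega
      · obtain ⟨t, ht⟩ : ∃ t : Fin (2 * q + 2),
            t.val = if y.val < (b i.1.2).val then y.val - 1 else y.val + 1 :=
          ⟨⟨if y.val < (b i.1.2).val then y.val - 1 else y.val + 1, by split_ifs <;> omega⟩, rfl⟩
        refine ⟨Sum.inr (Sum.inr t), ?_, ?_, ?_⟩
        · simp only [snd_mem_gPrimeRep_incidence, centralArc, Set.mem_ofPred_eq]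
          split_ifs at ht <;> omega
        · simp only [BGraph, fromRel_adj, ne_eq, Sum.inr.injEq, Fin.ext_iff]
          split_ifs at ht <;> omega
        · simp only [Sum.elim_inr]
          split_ifs at ht ⊢ <;> omega

lemma gPrimeRep_vertex_inter_incidence (ha : Function.Injective a) (v : V) (i : G.Incidences) :
    (gPrimeRep G a b (Sum.inl v) ∩ gPrimeRep G a b (Sum.inr (Sum.inr i))).Nonempty ↔
      i.1.1 ≠ v := by
  rw [ne_comm, ne_eq, ← ha.eq_iff, ← centralArc_subset_iff, Set.not_subset]
  constructor
  · rintro ⟨c | x | y, h₁, h₂⟩ <;> simp_all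
    exact ⟨x, h₁, h₂⟩
  · rintro ⟨x, h₁, h₂⟩
    exact ⟨Sum.inr (Sum.inl x), by simpa using h₁, by simpa using h₂⟩

lemma gPrimeRep_edge_inter_incidence (hb : Function.Injective b) (e : G.edgeSet)
    (i : G.Incidences) :
    (gPrimeRep G a b (Sum.inr (Sum.inl e)) ∩ gPrimeRep G a b (Sum.inr (Sum.inr i))).Nonempty ↔
      i.1.2 ≠ e := by
  rw [ne_comm, ne_eq, ← hb.eq_iff, ← centralArc_subset_iff, Set.not_subset]
  constructor
  · rintro ⟨c | x | y, h₁, h₂⟩ <;> simp_all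
    exact ⟨y, h₁, h₂⟩
  · rintro ⟨y, h₁, h₂⟩
    exact ⟨Sum.inr (Sum.inr y), by simpa using h₁, by simpa using h₂⟩

lemma gPrimeRep_vertex_inter_edge (v : V) (e : G.edgeSet) :
    ¬ (gPrimeRep G a b (Sum.inl v) ∩ gPrimeRep G a b (Sum.inr (Sum.inl e))).Nonempty := by
  rintro ⟨c | x | y, h₁, h₂⟩ <;> simp_all

lemma gPrime_adj_iff (ha : Function.Injective a) (hb : Function.Injective b)
    (u w : V ⊕ (G.edgeSet ⊕ G.Incidences)) (h : u ≠ w) :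
    G.gPrime.Adj u w ↔ (gPrimeRep G a b u ∩ gPrimeRep G a b w).Nonempty := by
  rcases u with v | e | i <;> rcases w with v' | e' | i'
  · obtain ⟨x, h₁, h₂⟩ := centralArc_inter_nonempty (a v) (a v')
    refine iff_of_true ?_ ⟨Sum.inr (Sum.inl x), by simpa using h₁, by simpa using h₂⟩
    simpa [SimpleGraph.gPrime, SimpleGraph.gThree, SimpleGraph.subdivTwice] using h
  · refine iff_of_false ?_ (gPrimeRep_vertex_inter_edge G a b v e')
    simp [SimpleGraph.gPrime, SimpleGraph.gThree, SimpleGraph.subdivTwice]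
  · rw [gPrimeRep_vertex_inter_incidence G a b ha]
    simp [SimpleGraph.gPrime, SimpleGraph.gThree, SimpleGraph.subdivTwice]
  · refine iff_of_false ?_ (Set.inter_comm _ _ ▸ gPrimeRep_vertex_inter_edge G a b v' e)
    simp [SimpleGraph.gPrime, SimpleGraph.gThree, SimpleGraph.subdivTwice]
  · obtain ⟨y, h₁, h₂⟩ := centralArc_inter_nonempty (b e) (b e')
    refine iff_of_true ?_ ⟨Sum.inr (Sum.inr y), by simpa using h₁, by simpa using h₂⟩
    simpa [SimpleGraph.gPrime, SimpleGraph.gThree, SimpleGraph.subdivTwice] using h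
  · rw [gPrimeRep_edge_inter_incidence G a b hb]
    simp [SimpleGraph.gPrime, SimpleGraph.gThree, SimpleGraph.subdivTwice]
  · rw [Set.inter_comm, gPrimeRep_vertex_inter_incidence G a b ha]
    simp [SimpleGraph.gPrime, SimpleGraph.gThree, SimpleGraph.subdivTwice]
  · rw [Set.inter_comm, gPrimeRep_edge_inter_incidence G a b hb]
    simp [SimpleGraph.gPrime, SimpleGraph.gThree, SimpleGraph.subdivTwice]
  · refine iff_of_true ?_ ⟨Sum.inl (), by simp, by simp⟩
    simpa [SimpleGraph.gPrime, SimpleGraph.gThree, SimpleGraph.subdivTwice] using h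

lemma eq_of_gPrimeRep_subset (ha : Function.Injective a) (hb : Function.Injective b)
    (u w : V ⊕ (G.edgeSet ⊕ G.Incidences)) (h : gPrimeRep G a b u ⊆ gPrimeRep G a b w) :
    u = w := by
  have hinter : (gPrimeRep G a b u ∩ gPrimeRep G a b w).Nonempty := by
    rw [Set.inter_eq_left.2 h]
    exact gPrimeRep_nonempty G a b u
  rcases u with v | e | i <;> rcases w with v' | e' | i'
  · refine congrArg _ (ha (centralArc_subset_iff.1 fun x hx => ?_))
    simpa using h ((fst_mem_gPrimeRep_vertex G a b v x).2 hx)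
  · exact absurd hinter (gPrimeRep_vertex_inter_edge G a b v e')
  · obtain ⟨x, h₁, h₂⟩ := centralArc_inter_nonempty (a v) (a i'.1.1)
    have hx := h ((fst_mem_gPrimeRep_vertex G a b v x).2 h₁)
    exact absurd h₂ (by simpa using hx)
  · rw [Set.inter_comm] at hinter
    exact absurd hinter (gPrimeRep_vertex_inter_edge G a b v' e)
  · refine congrArg _ (congrArg _ (hb (centralArc_subset_iff.1 fun y hy => ?_)))
    simpa using h ((snd_mem_gPrimeRep_edge G a b e y).2 hy)
  · obtain ⟨y, h₁, h₂⟩ := centralArc_inter_nonempty (b e) (b i'.1.2)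
    have hy := h ((snd_mem_gPrimeRep_edge G a b e y).2 h₁)
    exact absurd h₂ (by simpa using hy)
  · exact absurd (h (inl_mem_gPrimeRep_incidence G a b i ())) (by simp)
  · exact absurd (h (inl_mem_gPrimeRep_incidence G a b i ())) (by simp)
  · refine congrArg _ (congrArg _ (Subtype.ext (Prod.ext ?_ ?_)))
    · refine (ha (centralArc_subset_iff.1 fun x hx => ?_)).symm
      by_contra hx'
      exact absurd hx (by simpa using h ((fst_mem_gPrimeRep_incidence G a b i x).2 hx'))
    · refine (hb (centralArc_subset_iff.1 fun y hy => ?_)).symm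
      by_contra hy'
      exact absurd hy (by simpa using h ((snd_mem_gPrimeRep_incidence G a b i y).2 hy'))

end

/-- for a finite connected graph `G`, the graph `G'` is a proper `B`-graph,
where `B` is the 5-vertex graph of two triangles sharing a vertex. -/
theorem stmt9 {V : Type*} [Fintype V] (G : SimpleGraph V) (hc : G.Connected) :
    IsProperBGraph G.gPrime := by
  obtain ⟨p, ⟨a⟩⟩ := Finite.exists_equiv_fin V
  obtain ⟨q, ⟨b⟩⟩ := Finite.exists_equiv_fin G.edgeSet
  refine ⟨2 * p + 2, 2 * q + 2, by omega, by omega, gPrimeRep G a b, gPrimeRep_nonempty G a b,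
    gPrimeRep_connected G a b, gPrime_adj_iff G a b a.injective b.injective, ?_⟩
  intro u w hne h
  exact hne (eq_of_gPrimeRep_subset G a b a.injective b.injective u w h.subset)
end

section
/- Let G be a finite simple graph with a proper circular-arc representation f on ZMod n in which no vertex's arc equals all of ZMod n. If G contains three pairwise adjacent vertices u, v, w with f(u) ∩ f(v) ∩ f(w) = ∅ (a non-Helly triangle in this representation), then every induced cycle of G of length at least 4 has length at most 6. -/
open SimpleGraph
open scoped Classical

/-- Cut the circle at `c`.  An arc containing `a` and `b` contains everything between them in the
resulting linear order, or everything outside. -/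
lemma IsCircularArc.forall_between_or_forall_outside {n : ℕ} [NeZero n] {S : Set (ZMod n)}
    (hS : IsCircularArc S) (c : ZMod n) {a b : ZMod n} (ha : a ∈ S) (hb : b ∈ S)
    (hab : (a - c).val < (b - c).val) :
    (∀ t, (a - c).val ≤ (t - c).val → (t - c).val ≤ (b - c).val → t ∈ S) ∨
      (∀ t, (t - c).val ≤ (a - c).val ∨ (b - c).val ≤ (t - c).val → t ∈ S) := by
  have segment {p q : ℕ} (hpq : p ≤ q) (m : ℕ) (hm : (m : ZMod n) = (q : ZMod n) - p)
      (hmn : m < n) : m ≤ q - p := by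
    have h : (m : ZMod n) = ((q - p : ℕ) : ZMod n) := by rw [hm]; push_cast [hpq]; rfl
    have h' := congrArg ZMod.val h
    rw [ZMod.val_natCast, ZMod.val_natCast, Nat.mod_eq_of_lt hmn] at h'
    exact h' ▸ Nat.mod_le _ _
  obtain ⟨s, k, rfl⟩ := hS
  obtain ⟨i, hi, hai⟩ := ha
  obtain ⟨j, hj, hbj⟩ := hb
  have hal := ZMod.val_lt (a - c)
  have hbl := ZMod.val_lt (b - c)
  rcases le_total i j with hij | hij
  · left
    intro t hat htb
    have hm := segment hij ((b - c).val - (a - c).val)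
      (by push_cast [hab.le]; simp only [ZMod.natCast_zmod_val]; rw [hai, hbj]; ring) (by omega)
    refine ⟨i + ((t - c).val - (a - c).val), by omega, ?_⟩
    push_cast [hat]
    simp only [ZMod.natCast_zmod_val]
    rw [hai]; ring
  · right
    intro t ht
    have htl := ZMod.val_lt (t - c)
    have hm := segment hij (n + (a - c).val - (b - c).val)
      (by rw [Nat.cast_sub (by omega)]; push_cast; simp only [ZMod.natCast_zmod_val, ZMod.natCast_self]
          rw [hai, hbj]; ring) (by omega)
    rcases ht with ht | ht
    · refine ⟨j + (n + (t - c).val - (b - c).val), by omega, ?_⟩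
      rw [Nat.cast_add, Nat.cast_sub (by omega)]
      push_cast
      simp only [ZMod.natCast_zmod_val, ZMod.natCast_self]
      rw [hbj]; ring
    · refine ⟨j + ((t - c).val - (b - c).val), by omega, ?_⟩
      push_cast [ht]
      simp only [ZMod.natCast_zmod_val]
      rw [hbj]; ring

/-- If pairwise intersections of three arcs contain `x`, `y`, `z` but the arcs have no common point,
an arc avoiding `x`, `y`, `z` is strictly contained in one of the three.  Here `x` precedes `z` when
the circle is cut at `y`. -/
lemma IsCircularArc.ssubset_of_notMem_of_lt {n : ℕ} [NeZero n] {A U V W : Set (ZMod n)}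
    (hA : IsCircularArc A) (hU : IsCircularArc U) (hV : IsCircularArc V) (hW : IsCircularArc W)
    {x y z : ZMod n} (hxU : x ∈ U) (hxV : x ∈ V) (hyV : y ∈ V) (hyW : y ∈ W)
    (hzU : z ∈ U) (hzW : z ∈ W) (hxW : x ∉ W) (hyU : y ∉ U) (hzV : z ∉ V)
    (hxA : x ∉ A) (hyA : y ∉ A) (hzA : z ∉ A) (hxz : (x - y).val < (z - y).val) :
    A ⊂ U ∨ A ⊂ V ∨ A ⊂ W := by
  have hyy : (y - y).val = 0 := by simp
  have val_inj {s t : ZMod n} (h : (s - y).val = (t - y).val) : s = t :=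
    sub_left_injective (ZMod.val_injective n h)
  have separated {p : ZMod n} (hp : p ∉ A) {s t : ZMod n} (hs : s ∈ A) (ht : t ∈ A)
      (hsp : (s - y).val < (p - y).val) : (t - y).val < (p - y).val := by
    by_contra! hpt
    rcases hA.forall_between_or_forall_outside y hs ht (by omega) with h | h
    · exact hp (h p hsp.le hpt)
    · exact hyA (h y (by omega))
  have hyx : (y - y).val < (x - y).val := by
    have : (x - y).val ≠ (y - y).val := fun h => hyU (val_inj h ▸ hxU)
    omega
  have hUseg := (hU.forall_between_or_forall_outside y hxU hzU hxz).resolve_right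
    fun h => hyU (h y (by omega))
  have hVseg := (hV.forall_between_or_forall_outside y hyV hxV hyx).resolve_right
    fun h => hzV (h z (by omega))
  have hWseg := (hW.forall_between_or_forall_outside y hyW hzW (by omega)).resolve_left
    fun h => hxW (h x (by omega) hxz.le)
  have ssubset {S : Set (ZMod n)} {p : ZMod n} (hp : p ∉ A) (hpS : p ∈ S) (h : A ⊆ S) : A ⊂ S :=
    ⟨h, fun h' => hp (h' hpS)⟩
  by_cases h₁ : ∃ a ∈ A, (a - y).val < (x - y).val
  · obtain ⟨a, ha, hax⟩ := h₁
    refine Or.inr (Or.inl (ssubset hxA hxV fun t ht => hVseg t (by omega) ?_))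
    exact (separated hxA ha ht hax).le
  by_cases h₂ : ∃ a ∈ A, (a - y).val < (z - y).val
  · obtain ⟨a, ha, haz⟩ := h₂
    push Not at h₁
    exact Or.inl (ssubset hxA hxU fun t ht => hUseg t (h₁ t ht) (separated hzA ha ht haz).le)
  · push Not at h₂
    exact Or.inr (Or.inr (ssubset hyA hyW fun t ht => hWseg t (Or.inr (h₂ t ht))))

/-- If pairwise intersections of three arcs contain `x`, `y`, `z` but the arcs have no common point,
an arc avoiding `x`, `y`, `z` is strictly contained in one of the three. -/
lemma IsCircularArc.ssubset_of_notMem {n : ℕ} [NeZero n] {A U V W : Set (ZMod n)}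
    (hA : IsCircularArc A) (hU : IsCircularArc U) (hV : IsCircularArc V) (hW : IsCircularArc W)
    {x y z : ZMod n} (hxU : x ∈ U) (hxV : x ∈ V) (hyV : y ∈ V) (hyW : y ∈ W)
    (hzU : z ∈ U) (hzW : z ∈ W) (hxW : x ∉ W) (hyU : y ∉ U) (hzV : z ∉ V)
    (hxA : x ∉ A) (hyA : y ∉ A) (hzA : z ∉ A) :
    A ⊂ U ∨ A ⊂ V ∨ A ⊂ W := by
  rcases lt_trichotomy (x - y).val (z - y).val with h | h | h
  · exact hA.ssubset_of_notMem_of_lt hU hV hW hxU hxV hyV hyW hzU hzW hxW hyU hzV hxA hyA hzA h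
  · exact absurd (sub_left_injective (ZMod.val_injective n h) ▸ hxV) hzV
  · have := hA.ssubset_of_notMem_of_lt hU hW hV hzU hzW hyW hyV hxU hxV hzV hyU hxW hzA hyA hxA h
    tauto

/-- A cycle of length at least `4` has no triangle. -/
lemma cycleGraph_not_adj_of_adj_of_adj {k : ℕ} (hk : 4 ≤ k) {a b c : Fin k}
    (hab : (cycleGraph k).Adj a b) (hac : (cycleGraph k).Adj a c) :
    ¬ (cycleGraph k).Adj b c := by
  rw [cycleGraph_adj'] at *
  have sub_val (p q : Fin k) : (q ≤ p ∧ (p - q).val + q.val = p.val) ∨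
      (p < q ∧ (p - q).val + q.val = k + p.val) := by
    rcases le_or_gt q p with h | h
    · have := Fin.coe_sub_iff_le.2 h
      omega
    · have := Fin.coe_sub_iff_lt.2 h
      omega
  have := sub_val a b
  have := sub_val b a
  have := sub_val a c
  have := sub_val c a
  have := sub_val b c
  have := sub_val c b
  omega

/-- if `G` has a proper circular-arc representation on `ZMod n` in which no
arc is all of `ZMod n` and which contains a non-Helly triangle, then every induced cycle of
`G` of length at least `4` has length at most `6`. -/
theorem stmt10 {V : Type*} [Fintype V] (G : SimpleGraph V) (n : ℕ) (hn : 1 ≤ n)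
    (f : V → Set (ZMod n)) (hrep : IsProperCircularArcRep G f)
    (hfull : ∀ v, f v ≠ Set.univ)
    (u v w : V) (huv : G.Adj u v) (huw : G.Adj u w) (hvw : G.Adj v w)
    (hnonHelly : f u ∩ f v ∩ f w = ∅) :
    ∀ k : ℕ, 4 ≤ k → Nonempty (SimpleGraph.cycleGraph k ↪g G) → k ≤ 6 := by
  intro k hk ⟨φ⟩
  have : NeZero n := ⟨by omega⟩
  obtain ⟨harc, hadj, hproper⟩ := hrep
  obtain ⟨x, hxu, hxv⟩ := (hadj u v huv.ne).1 huv
  obtain ⟨y, hyv, hyw⟩ := (hadj v w hvw.ne).1 hvw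
  obtain ⟨z, hzu, hzw⟩ := (hadj u w huw.ne).1 huw
  have no_common (t : ZMod n) (htu : t ∈ f u) (htv : t ∈ f v) (htw : t ∈ f w) : False :=
    hnonHelly.subset ⟨⟨htu, htv⟩, htw⟩
  have not_ssubset (s t : V) : ¬ f s ⊂ f t := fun h =>
    hproper s t (fun hst => h.ne (congrArg f hst)) h
  have hits (i : Fin k) : ∃ p ∈ ({x, y, z} : Finset (ZMod n)), p ∈ f (φ i) := by
    by_contra! h
    rcases (harc (φ i)).ssubset_of_notMem (harc u) (harc v) (harc w) hxu hxv hyv hyw hzu hzw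
      (no_common x hxu hxv) (fun hyu => no_common y hyu hyv hyw)
      (fun hzv => no_common z hzu hzv hzw)
      (h x (by simp)) (h y (by simp)) (h z (by simp)) with h | h | h
    all_goals exact not_ssubset _ _ h
  choose g hg hgmem using hits
  by_contra! hk6
  obtain ⟨p, -, hp⟩ := Finset.exists_lt_card_fiber_of_mul_lt_card_of_maps_to (n := 2)
    (s := Finset.univ) (fun i _ => hg i) (by
      have := Finset.card_le_three (a := x) (b := y) (c := z)
      rw [Finset.card_univ, Fintype.card_fin]
      omega)
  obtain ⟨a, ha, b, hb, c, hc, hab, hac, hbc⟩ := Finset.two_lt_card.1 hp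
  simp only [Finset.mem_filter, Finset.mem_univ, true_and] at ha hb hc
  have adj {i j : Fin k} (hi : g i = p) (hj : g j = p) (hij : i ≠ j) :
      (cycleGraph k).Adj i j :=
    φ.map_adj_iff.1 <| (hadj _ _ (φ.injective.ne hij)).2 ⟨p, hi ▸ hgmem i, hj ▸ hgmem j⟩
  exact cycleGraph_not_adj_of_adj_of_adj hk (adj ha hb hab) (adj ha hc hac) (adj hb hc hbc)
end
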